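/- Let 𝒮 be a finite seed set with 1 ≤ log₂|𝒮| < log₂ N, and let G : 𝒮 → {-1,1}^N be a random generator whose entries e_n(s) are independent uniform ±1 random variables. Then with probability tending to 1 as N → ∞ one has Φ̃_k(G) < 2·√(N·(log C(N,k) + k·log|𝒮|)) for every integer k with 2 ≤ k ≤ N/(6·log₂|𝒮|). -/

import Mathlib

/-- The value `±1` associated to a Boolean. -/
def pmVal (b : Bool) : ℤ := if b then 1 else -1

/-- Entry of a binary sequence `E ∈ {-1,1}^N` at (0-based) position `t`,
defaulting to `1` out of range. -/
def seqAt {N : ℕ} (E : Fin N → Bool) (t : ℕ) : ℤ :=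
  if h : t < N then pmVal (E ⟨t, h⟩) else 1

/-- Set of values `|V_{k₁,…,k_ℓ}(E_N(s₁),…,E_N(s_ℓ),M,D)|` over all admissible
parameters: `ℓ ≥ 1`, `k₁,…,k_ℓ ≥ 1` with `k₁ + … + k_ℓ = k`, distinct seeds
`s₁,…,s_ℓ`, `1 ≤ M`, and shifts `0 ≤ dⁱ₁ < … < dⁱ_{kᵢ}` with `M + dⁱ_{kᵢ} ≤ N`. -/
def genCorrSet {S : Type*} {N : ℕ} (k : ℕ) (G : S → Fin N → Bool) : Set ℕ :=
  {v | ∃ (ℓ : ℕ) (κ : Fin ℓ → ℕ) (s : Fin ℓ → S) (M : ℕ)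
        (d : (i : Fin ℓ) → Fin (κ i) → ℕ),
      1 ≤ ℓ ∧ (∀ i, 1 ≤ κ i) ∧ (∑ i, κ i) = k ∧ Function.Injective s ∧
      1 ≤ M ∧ (∀ i, StrictMono (d i)) ∧ (∀ i j, M + d i j ≤ N) ∧
      v = (∑ n ∈ Finset.range M, ∏ i, ∏ j, seqAt (G (s i)) (n + d i j)).natAbs}

/-- The cross-correlation measure `Φ̃ₖ(G)` of order `k` of a generator
`G : 𝒮 → {-1,1}^N`. -/
noncomputable def genCrossCorr {S : Type*} {N : ℕ} (k : ℕ) (G : S → Fin N → Bool) : ℕ :=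
  sSup (genCorrSet k G)

open Finset in
/-- The correlation sum of length `M` along a set `D` of (seed, shift) pairs. -/
def corrSum {S : Type*} {N : ℕ} (D : Finset (S × ℕ)) (M : ℕ) (G : S → Fin N → Bool) : ℤ :=
  ∑ n ∈ range M, ∏ p ∈ D, seqAt (G p.1) (n + p.2)

/-- Flip the entry at seed `s` and position `m`. -/
def flipEntry {S : Type*} [DecidableEq S] {N : ℕ} (s : S) (m : ℕ) (G : S → Fin N → Bool) :
    S → Fin N → Bool :=
  fun a b => if a = s ∧ (b : ℕ) = m then !G a b else G a b

lemma flipEntry_involutive {S : Type*} [DecidableEq S] {N : ℕ} (s : S) (m : ℕ) :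
    Function.Involutive (flipEntry (N := N) s m) := by
  intro G
  ext a b
  by_cases h : a = s ∧ (b : ℕ) = m <;> simp [flipEntry, h]

lemma seqAt_flipEntry_of_ne {S : Type*} [DecidableEq S] {N : ℕ} {s a : S} {m t : ℕ}
    (G : S → Fin N → Bool) (h : ¬ (a = s ∧ t = m)) :
    seqAt (flipEntry s m G a) t = seqAt (G a) t := by
  simp [seqAt, flipEntry, h]

lemma seqAt_flipEntry_self {S : Type*} [DecidableEq S] {N : ℕ} {s : S} {m : ℕ}
    (G : S → Fin N → Bool) (h : m < N) :
    seqAt (flipEntry s m G s) m = - seqAt (G s) m := by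
  cases hG : G s ⟨m, h⟩ <;> simp [seqAt, flipEntry, h, pmVal, hG]

lemma seqAt_eq_one_or {N : ℕ} (E : Fin N → Bool) (t : ℕ) : seqAt E t = 1 ∨ seqAt E t = -1 := by
  unfold seqAt pmVal
  split_ifs <;> simp

lemma prod_seqAt_eq_one_or {S : Type*} {N : ℕ} (D : Finset (S × ℕ)) (n : ℕ)
    (G : S → Fin N → Bool) :
    ∏ p ∈ D, seqAt (G p.1) (n + p.2) = 1 ∨ ∏ p ∈ D, seqAt (G p.1) (n + p.2) = -1 := by
  refine Finset.prod_induction _ (fun x : ℤ => x = 1 ∨ x = -1) ?_ (Or.inl rfl)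
    fun p _ => seqAt_eq_one_or _ _
  rintro a b (rfl | rfl) (rfl | rfl) <;> simp

open Finset in
/-- The moment generating function of a correlation sum is that of `M` independent signs. -/
lemma sum_exp_corrSum {S : Type*} [Fintype S] [DecidableEq S] {N : ℕ} (D : Finset (S × ℕ))
    (hD : D.Nonempty) (x : ℝ) (M : ℕ) (hM : ∀ p ∈ D, M + p.2 ≤ N) :
    ∑ G : S → Fin N → Bool, Real.exp (x * corrSum D M G) =
      Fintype.card (S → Fin N → Bool) * Real.cosh x ^ M := by
  induction M with
  | zero => simp [corrSum]
  | succ M ih =>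
    obtain ⟨q, hq, hmax⟩ := D.exists_max_image (fun p => p.2) hD
    set e := (flipEntry_involutive (N := N) q.1 (M + q.2)).toPerm with he
    have hlt : M + q.2 < N := by have := hM q hq; omega
    have hX : ∀ G : S → Fin N → Bool, ∏ p ∈ D, seqAt (e G p.1) (M + p.2) =
        - ∏ p ∈ D, seqAt (G p.1) (M + p.2) := by
      intro G
      rw [← mul_prod_erase _ _ hq, ← mul_prod_erase (a := q) _ _ hq, ← neg_mul]
      congr 1
      · exact seqAt_flipEntry_self G hlt
      · refine prod_congr rfl fun p hp => seqAt_flipEntry_of_ne G ?_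
        rintro ⟨h1, h2⟩
        exact (mem_erase.1 hp).1 (Prod.ext h1 (by omega))
    have hV : ∀ G : S → Fin N → Bool, corrSum D M (e G) = corrSum D M G := by
      intro G
      refine sum_congr rfl fun n hn => prod_congr rfl fun p hp => seqAt_flipEntry_of_ne G ?_
      rintro ⟨-, h2⟩
      have := hmax p hp
      have := mem_range.1 hn
      omega
    have hsucc : ∀ G : S → Fin N → Bool, corrSum D (M + 1) G =
        corrSum D M G + ∏ p ∈ D, seqAt (G p.1) (M + p.2) := fun G => sum_range_succ _ _
    have hcosh : ∀ G : S → Fin N → Bool,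
        Real.exp (x * corrSum D (M + 1) G) + Real.exp (x * corrSum D (M + 1) (e G)) =
          2 * Real.cosh x * Real.exp (x * corrSum D M G) := by
      intro G
      rw [hsucc, hsucc, hV, hX, Real.cosh_eq]
      rcases prod_seqAt_eq_one_or D M G with h | h <;> rw [h] <;> push_cast <;>
        simp only [mul_add, Real.exp_add] <;> ring_nf
    have hsum : 2 * ∑ G : S → Fin N → Bool, Real.exp (x * corrSum D (M + 1) G) =
        2 * Real.cosh x * ∑ G : S → Fin N → Bool, Real.exp (x * corrSum D M G) := by
      rw [mul_sum (a := 2 * Real.cosh x), ← sum_congr rfl fun G _ => hcosh G, sum_add_distrib,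
        Equiv.sum_comp e fun G => Real.exp (x * corrSum D (M + 1) G), two_mul]
    rw [ih fun p hp => by have := hM p hp; omega] at hsum
    rw [pow_succ]
    linarith

open Finset in
/-- Hoeffding's inequality for a correlation sum, in counting form. -/
lemma card_le_natAbs_corrSum {S : Type*} [Fintype S] [DecidableEq S] {N : ℕ} (D : Finset (S × ℕ))
    (hD : D.Nonempty) {M : ℕ} (hM : ∀ p ∈ D, M + p.2 ≤ N) (hN : 0 < N) {t : ℝ} (ht : 0 ≤ t) :
    (#{G : S → Fin N → Bool | t ≤ ((corrSum D M G).natAbs : ℝ)} : ℝ) ≤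
      Fintype.card (S → Fin N → Bool) * (2 * Real.exp (-(t ^ 2 / (2 * N)))) := by
  have hN' : (0 : ℝ) < N := by exact_mod_cast hN
  have hMN : (M : ℝ) ≤ N := by
    obtain ⟨p, hp⟩ := hD
    have := hM p hp
    exact_mod_cast (by omega : M ≤ N)
  set x : ℝ := t / N with hx
  have hx0 : 0 ≤ x := by positivity
  have hcosh : Real.cosh x ^ M ≤ Real.exp (t ^ 2 / (2 * N)) := by
    calc Real.cosh x ^ M ≤ Real.exp (x ^ 2 / 2) ^ M := by
          gcongr
          exact Real.cosh_le_exp_half_sq x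
      _ = Real.exp (M * (x ^ 2 / 2)) := by rw [← Real.exp_nat_mul]
      _ ≤ Real.exp (N * (x ^ 2 / 2)) := by gcongr
      _ = Real.exp (t ^ 2 / (2 * N)) := by rw [hx]; congr 1; field_simp
  have hpos := sum_exp_corrSum D hD x M hM
  have hneg := sum_exp_corrSum D hD (-x) M hM
  rw [Real.cosh_neg] at hneg
  have key : (#{G : S → Fin N → Bool | t ≤ ((corrSum D M G).natAbs : ℝ)} : ℝ) * Real.exp (x * t) ≤
      ∑ G : S → Fin N → Bool,
        (Real.exp (x * corrSum D M G) + Real.exp (-x * corrSum D M G)) := by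
    rw [← nsmul_eq_mul]
    refine (card_nsmul_le_sum _ _ _ fun G hG => ?_).trans
      (sum_le_sum_of_subset_of_nonneg (subset_univ _) fun _ _ _ => by positivity)
    have hG' : t ≤ |((corrSum D M G : ℤ) : ℝ)| := by
      simpa [Nat.cast_natAbs] using hG
    rcases le_abs.1 hG' with h | h
    · have : Real.exp (x * t) ≤ Real.exp (x * corrSum D M G) := by gcongr
      have := Real.exp_pos (-x * corrSum D M G)
      linarith
    · have : Real.exp (x * t) ≤ Real.exp (-x * corrSum D M G) := by
        rw [neg_mul_comm]
        gcongr
      have := Real.exp_pos (x * corrSum D M G)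
      linarith
  rw [sum_add_distrib, hpos, hneg] at key
  have hxt : x * t = t ^ 2 / (2 * N) + t ^ 2 / (2 * N) := by rw [hx]; field_simp; ring
  rw [hxt, Real.exp_add] at key
  set c := Real.exp (t ^ 2 / (2 * N)) with hc
  have hc0 : 0 < c := Real.exp_pos _
  rw [Real.exp_neg, ← hc]
  have hcard : (0 : ℝ) ≤ Fintype.card (S → Fin N → Bool) := by positivity
  have h2 := mul_le_mul_of_nonneg_left hcosh hcard
  rw [← mul_assoc, ← div_eq_mul_inv, le_div_iff₀ hc0]
  refine le_of_mul_le_mul_right ?_ hc0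
  linarith

open Finset in
/-- Every element of `genCorrSet k G` is the absolute value of a correlation sum along a set of
`k` pairs. -/
lemma exists_corrSum_of_mem_genCorrSet {S : Type*} [Fintype S] {N k v : ℕ}
    {G : S → Fin N → Bool} (hv : v ∈ genCorrSet k G) :
    ∃ M ∈ Icc 1 N, ∃ D ∈ powersetCard k ((univ : Finset S) ×ˢ range N),
      D.Nonempty ∧ (∀ p ∈ D, M + p.2 ≤ N) ∧ v = (corrSum D M G).natAbs := by
  obtain ⟨ℓ, κ, s, M, d, hℓ, hκ, hk, hs, hM, hd, hdN, rfl⟩ := hv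
  let f : (Σ i : Fin ℓ, Fin (κ i)) ↪ S × ℕ :=
    ⟨fun a => (s a.1, d a.1 a.2), by
      rintro ⟨i, j⟩ ⟨i', j'⟩ h
      obtain ⟨h1, h2⟩ := Prod.ext_iff.1 h
      obtain rfl := hs h1
      obtain rfl := (hd i).injective h2
      rfl⟩
  have h0 : M + d ⟨0, hℓ⟩ ⟨0, hκ _⟩ ≤ N := hdN _ _
  refine ⟨M, mem_Icc.2 ⟨hM, by omega⟩, univ.map f, ?_, ?_, ?_, ?_⟩
  · rw [mem_powersetCard]
    refine ⟨?_, by simp [hk]⟩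
    intro p hp
    obtain ⟨a, -, rfl⟩ := mem_map.1 hp
    have := hdN a.1 a.2
    simp only [mem_product, mem_univ, mem_range, true_and]
    change d a.1 a.2 < N
    omega
  · exact ⟨f ⟨⟨0, hℓ⟩, ⟨0, hκ _⟩⟩, mem_map_of_mem _ (mem_univ _)⟩
  · intro p hp
    obtain ⟨a, -, rfl⟩ := mem_map.1 hp
    exact hdN a.1 a.2
  · simp only [corrSum, prod_map, Fintype.prod_sigma]
    rfl

lemma sSup_mem_of_pos {s : Set ℕ} (h : 0 < sSup s) : sSup s ∈ s := by
  refine Nat.sSup_mem ?_ ?_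
  · by_contra hs
    simp [Set.not_nonempty_iff_eq_empty.1 hs] at h
  · by_contra hs
    simp [Nat.sSup_of_not_bddAbove hs] at h

lemma choose_two_le_choose {N k : ℕ} (hk : 2 ≤ k) (hkN : 2 * k ≤ N) :
    N.choose 2 ≤ N.choose k := by
  induction k, hk using Nat.le_induction with
  | base => rfl
  | succ k _ ih =>
    exact (ih (by omega)).trans (Nat.choose_le_succ_of_lt_half_left (by omega))

/-- The union bound over all sets of `k` pairs, at the Hoeffding rate. -/
lemma choose_mul_div_sq_le {N k q : ℕ} (hq : 2 ≤ q) (hk : 2 ≤ k) (hkN : 6 * k ≤ N) :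
    (N : ℝ) * ((q * N).choose k * (2 * (((N.choose k : ℝ) * (q : ℝ) ^ k) ^ 2)⁻¹)) ≤
      4 / ((N : ℝ) - 1) * (3 / 5) ^ k := by
  have hNk : 6 * (k : ℝ) ≤ N := by exact_mod_cast hkN
  have hk' : 2 ≤ (k : ℝ) := by exact_mod_cast hk
  have hq' : 2 ≤ (q : ℝ) := by exact_mod_cast hq
  have hf : (0 : ℝ) < (k.factorial : ℝ) := by positivity
  set C : ℝ := (N.choose k : ℝ) with hC
  have hCpos : 0 < C := by
    rw [hC]; exact_mod_cast Nat.choose_pos (by omega)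
  have h1 : ((q * N).choose k : ℝ) ≤ (q : ℝ) ^ k * (N : ℝ) ^ k / k.factorial := by
    have := Nat.choose_le_pow_div (α := ℝ) k (q * N)
    rwa [Nat.cast_mul, mul_pow] at this
  have h2 : (5 / 6 : ℝ) ^ k * (N : ℝ) ^ k ≤ k.factorial * C := by
    have h := Nat.pow_sub_le_descFactorial N k
    rw [Nat.descFactorial_eq_factorial_mul_choose] at h
    have h' : (((N + 1 - k : ℕ) : ℝ)) ^ k ≤ k.factorial * C := by
      rw [hC]; exact_mod_cast h
    refine le_trans ?_ h'
    rw [← mul_pow]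
    gcongr
    rw [Nat.cast_sub (by omega)]
    push_cast
    linarith
  have h3 : ((q * N).choose k : ℝ) ≤ (q : ℝ) ^ k * ((6 / 5) ^ k * C) := by
    refine h1.trans ?_
    rw [div_le_iff₀ hf, mul_assoc]
    gcongr
    have : (N : ℝ) ^ k = (6 / 5) ^ k * ((5 / 6) ^ k * (N : ℝ) ^ k) := by
      rw [← mul_assoc, ← mul_pow]; norm_num
    rw [this, mul_assoc, mul_comm C]
    gcongr
  have h4 : (N : ℝ) * (N - 1) / 2 ≤ C := by
    rw [← Nat.cast_choose_two, hC]
    exact_mod_cast choose_two_le_choose hk (by omega)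
  have hqk : (0 : ℝ) < (q : ℝ) ^ k := by positivity
  have hN0 : (0 : ℝ) < N := by linarith
  have hN1 : (0 : ℝ) < (N : ℝ) - 1 := by linarith
  calc (N : ℝ) * ((q * N).choose k * (2 * ((C * (q : ℝ) ^ k) ^ 2)⁻¹))
      ≤ N * ((q : ℝ) ^ k * ((6 / 5) ^ k * C) * (2 * ((C * (q : ℝ) ^ k) ^ 2)⁻¹)) := by gcongr
    _ = 2 * N * (6 / 5) ^ k / (C * (q : ℝ) ^ k) := by field_simp
    _ ≤ 2 * N * (6 / 5) ^ k / ((N : ℝ) * (N - 1) / 2 * 2 ^ k) := by gcongr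
    _ = 4 / ((N : ℝ) - 1) * (3 / 5) ^ k := by
      rw [show (3 / 5 : ℝ) = (6 / 5) / 2 by norm_num, div_pow (6 / 5 : ℝ) 2]
      field_simp
      norm_num

lemma sum_three_fifths_pow_le (s : Finset ℕ) : ∑ k ∈ s, (3 / 5 : ℝ) ^ k ≤ 5 / 2 := by
  have h := (summable_geometric_of_lt_one (by norm_num : (0 : ℝ) ≤ 3 / 5) (by norm_num)).sum_le_tsum
    s fun _ _ => by positivity
  rw [tsum_geometric_of_lt_one (by norm_num) (by norm_num)] at h
  norm_num at h ⊢
  exact h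

open Finset in
/-- Outside the good event, a correlation sum along some set of `k ≤ N / 6` pairs is large. The
number of such generators is at most a `10 / (N - 1)` fraction of all generators. -/
lemma card_large_corrSum_le {S : Type*} [Fintype S] [DecidableEq S] {N : ℕ}
    (hq : 2 ≤ Fintype.card S) (hN : 2 ≤ N) (B : Finset (S → Fin N → Bool))
    (hB : ∀ G ∈ B, ∃ k ∈ Icc 2 (N / 6), ∃ M ∈ Icc 1 N,
      ∃ D ∈ powersetCard k ((univ : Finset S) ×ˢ range N), D.Nonempty ∧
        (∀ p ∈ D, M + p.2 ≤ N) ∧ 2 * Real.sqrt ((N : ℝ) *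
          (Real.log (N.choose k) + k * Real.log (Fintype.card S))) ≤
            ((corrSum D M G).natAbs : ℝ)) :
    (#B : ℝ) ≤ 10 / ((N : ℝ) - 1) * Fintype.card (S → Fin N → Bool) := by
  set q := Fintype.card S with hqdef
  set Ω : ℝ := ((Fintype.card (S → Fin N → Bool) : ℕ) : ℝ) with hΩ
  have hΩ0 : 0 ≤ Ω := by positivity
  have hN0 : (0 : ℝ) < N := by exact_mod_cast (by omega : 0 < N)
  have hN1 : (0 : ℝ) < (N : ℝ) - 1 := by
    have : (2 : ℝ) ≤ N := by exact_mod_cast hN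
    linarith
  let t : ℕ → ℝ := fun k =>
    2 * Real.sqrt ((N : ℝ) * (Real.log (N.choose k) + k * Real.log q))
  let E : ℕ → ℕ → Finset (S × ℕ) → Finset (S → Fin N → Bool) := fun k M D =>
    {G | D.Nonempty ∧ (∀ p ∈ D, M + p.2 ≤ N) ∧ t k ≤ ((corrSum D M G).natAbs : ℝ)}
  have hsub : B ⊆ (Icc 2 (N / 6)).biUnion fun k => (Icc 1 N).biUnion fun M =>
      (powersetCard k ((univ : Finset S) ×ˢ range N)).biUnion fun D => E k M D := by
    intro G hG
    obtain ⟨k, hk, M, hM, D, hD, h⟩ := hB G hG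
    simp only [mem_biUnion]
    exact ⟨k, hk, M, hM, D, hD, mem_filter.2 ⟨mem_univ _, h⟩⟩
  have hE : ∀ k ∈ Icc 2 (N / 6), ∀ M D, (#(E k M D) : ℝ) ≤
      Ω * (2 * (((N.choose k : ℝ) * (q : ℝ) ^ k) ^ 2)⁻¹) := by
    intro k hk M D
    by_cases h : D.Nonempty ∧ ∀ p ∈ D, M + p.2 ≤ N
    · have hC : (0 : ℝ) < N.choose k := by
        have := (mem_Icc.1 hk).2
        exact_mod_cast Nat.choose_pos (by omega)
      have hq0 : (0 : ℝ) < q := by exact_mod_cast (by omega : 0 < q)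
      have hL : Real.log (N.choose k) + k * Real.log q =
          Real.log ((N.choose k : ℝ) * (q : ℝ) ^ k) := by
        rw [Real.log_mul hC.ne' (by positivity), Real.log_pow]
      have hL0 : 0 ≤ Real.log (N.choose k) + k * Real.log q :=
        add_nonneg (Real.log_natCast_nonneg _)
          (mul_nonneg (Nat.cast_nonneg _) (Real.log_natCast_nonneg _))
      have ht : Real.exp (-(t k ^ 2 / (2 * N))) = (((N.choose k : ℝ) * (q : ℝ) ^ k) ^ 2)⁻¹ := by
        have : t k ^ 2 / (2 * N) =
            Real.log ((N.choose k : ℝ) * (q : ℝ) ^ k) +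
              Real.log ((N.choose k : ℝ) * (q : ℝ) ^ k) := by
          simp only [t]
          rw [mul_pow, Real.sq_sqrt (by positivity), hL]
          field_simp
          ring
        rw [this, Real.exp_neg, Real.exp_add, Real.exp_log (by positivity), sq]
      rw [← ht]
      refine le_trans ?_ (card_le_natAbs_corrSum D h.1 h.2 (by omega) (by positivity))
      exact_mod_cast card_le_card fun G hG => by
        simp only [E, mem_filter] at hG ⊢
        exact ⟨hG.1, hG.2.2.2⟩
    · have : E k M D = ∅ := by
        refine filter_eq_empty_iff.2 fun G _ hG => h ⟨hG.1, hG.2.1⟩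
      rw [this]
      simp only [card_empty, Nat.cast_zero]
      positivity
  have hk : ∀ k ∈ Icc 2 (N / 6), (#((Icc 1 N).biUnion fun M =>
      (powersetCard k ((univ : Finset S) ×ˢ range N)).biUnion fun D => E k M D) : ℝ) ≤
        Ω * (4 / ((N : ℝ) - 1) * (3 / 5) ^ k) := by
    intro k hk
    obtain ⟨hk2, hk6⟩ := mem_Icc.1 hk
    set b : ℝ := Ω * (2 * (((N.choose k : ℝ) * (q : ℝ) ^ k) ^ 2)⁻¹) with hb
    have hD : ∀ M, (#((powersetCard k ((univ : Finset S) ×ˢ range N)).biUnion fun D => E k M D) : ℝ)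
        ≤ (q * N).choose k * b := by
      intro M
      refine (Nat.cast_le.2 card_biUnion_le).trans ?_
      rw [Nat.cast_sum]
      refine (sum_le_card_nsmul _ _ b fun D _ => hE k hk M D).trans ?_
      rw [nsmul_eq_mul, card_powersetCard, card_product, card_univ, card_range]
    refine (Nat.cast_le.2 card_biUnion_le).trans ?_
    rw [Nat.cast_sum]
    refine (sum_le_card_nsmul _ _ _ fun M _ => hD M).trans ?_
    rw [nsmul_eq_mul, Nat.card_Icc, Nat.add_sub_cancel]
    have := mul_le_mul_of_nonneg_left (choose_mul_div_sq_le (N := N) hq hk2 (by omega)) hΩ0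
    refine le_trans (le_of_eq ?_) this
    rw [hb]
    ring
  calc (#B : ℝ) ≤ ∑ k ∈ Icc 2 (N / 6), Ω * (4 / ((N : ℝ) - 1) * (3 / 5) ^ k) := by
        refine (Nat.cast_le.2 ((card_le_card hsub).trans card_biUnion_le)).trans ?_
        rw [Nat.cast_sum]
        exact sum_le_sum hk
    _ = Ω * (4 / ((N : ℝ) - 1)) * ∑ k ∈ Icc 2 (N / 6), (3 / 5 : ℝ) ^ k := by
        rw [mul_sum]
        exact sum_congr rfl fun _ _ => by ring
    _ ≤ Ω * (4 / ((N : ℝ) - 1)) * (5 / 2) := by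
        gcongr
        exact sum_three_fifths_pow_le _
    _ = 10 / ((N : ℝ) - 1) * Ω := by ring

/-- If `1 ≤ log₂|𝒮| < log₂ N`, then with probability tending to `1` as `N → ∞`, a random
generator `G : 𝒮 → {-1,1}^N` (entries independent uniform `±1`) satisfies
`Φ̃ₖ(G) < 2·√(N(log C(N,k) + k log|𝒮|))` for every `k` with `2 ≤ k ≤ N/(6 log₂|𝒮|)`. -/
theorem upper_bound_cross_correlation_small_seed_set :
    ∀ ε : ℝ, 0 < ε → ∃ N₀ : ℕ, ∀ N : ℕ, N₀ ≤ N →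
    ∀ (S : Type) [Fintype S],
      1 ≤ Real.logb 2 (Fintype.card S) →
      Real.logb 2 (Fintype.card S) < Real.logb 2 N →
    (1 - ε) * (Nat.card (S → Fin N → Bool) : ℝ) ≤
      ({G : S → Fin N → Bool |
        ∀ k : ℕ, 2 ≤ k → (k : ℝ) ≤ (N : ℝ) / (6 * Real.logb 2 (Fintype.card S)) →
          (genCrossCorr k G : ℝ) < 2 * Real.sqrt ((N : ℝ) *
              (Real.log (N.choose k) + k * Real.log (Fintype.card S)))}.ncard : ℝ) := by
  intro ε hε
  refine ⟨⌈10 / ε⌉₊ + 2, fun N hN S _ hS _ => ?_⟩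
  classical
  have hqpos : 0 < Fintype.card S := by
    by_contra h
    rw [Nat.eq_zero_of_not_pos h] at hS
    norm_num at hS
  have hq : 2 ≤ Fintype.card S := by
    have h := (Real.le_logb_iff_rpow_le (by norm_num) (by exact_mod_cast hqpos)).1 hS
    rw [Real.rpow_one] at h
    exact_mod_cast h
  have hεN : 10 / ε ≤ (N : ℝ) - 1 := by
    have h1 := Nat.le_ceil (10 / ε)
    have h2 : ((⌈10 / ε⌉₊ + 2 : ℕ) : ℝ) ≤ N := by exact_mod_cast hN
    push_cast at h2
    linarith
  have hN1 : (0 : ℝ) < (N : ℝ) - 1 := lt_of_lt_of_le (by positivity) hεN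
  set A : Set (S → Fin N → Bool) := {G : S → Fin N → Bool |
    ∀ k : ℕ, 2 ≤ k → (k : ℝ) ≤ (N : ℝ) / (6 * Real.logb 2 (Fintype.card S)) →
      (genCrossCorr k G : ℝ) < 2 * Real.sqrt ((N : ℝ) *
          (Real.log (N.choose k) + k * Real.log (Fintype.card S)))} with hA
  have hbad := card_large_corrSum_le hq (by omega) Aᶜ.toFinset (N := N) (by
    intro G hG
    rw [Set.mem_toFinset, Set.mem_compl_iff, hA, Set.mem_ofPred_eq] at hG
    push Not at hG
    obtain ⟨k, hk2, hkN, hlarge⟩ := hG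
    have hk6 : k ≤ N / 6 := by
      rw [Nat.le_div_iff_mul_le (by norm_num)]
      rw [le_div_iff₀ (by positivity)] at hkN
      have h0 : (0 : ℝ) ≤ k := Nat.cast_nonneg k
      exact_mod_cast (by nlinarith : (k : ℝ) * 6 ≤ N)
    have hpos : 0 < 2 * Real.sqrt ((N : ℝ) *
        (Real.log (N.choose k) + k * Real.log (Fintype.card S))) := by
      have h1 := Real.log_natCast_nonneg (N.choose k)
      have h2 : 0 < Real.log (Fintype.card S) := Real.log_pos (by exact_mod_cast hq)
      have h3 : (0 : ℝ) < k := by exact_mod_cast (by omega : 0 < k)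
      have h4 : (0 : ℝ) < N := by linarith
      positivity
    have hmem := sSup_mem_of_pos (s := genCorrSet k G)
      (by exact_mod_cast lt_of_lt_of_le hpos hlarge)
    obtain ⟨M, hM, D, hD, hne, hDN, hv⟩ := exists_corrSum_of_mem_genCorrSet hmem
    refine ⟨k, Finset.mem_Icc.2 ⟨hk2, hk6⟩, M, hM, D, hD, hne, hDN, ?_⟩
    rw [← hv]
    exact hlarge)
  rw [← Set.ncard_eq_toFinset_card' Aᶜ] at hbad
  have hadd : (A.ncard : ℝ) + (Aᶜ.ncard : ℝ) = Nat.card (S → Fin N → Bool) := by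
    exact_mod_cast Set.ncard_add_ncard_compl A
  rw [← Nat.card_eq_fintype_card] at hbad
  have hε' : 10 / ((N : ℝ) - 1) ≤ ε := by
    rw [div_le_iff₀ hN1]
    rw [div_le_iff₀ hε] at hεN
    linarith
  have := mul_le_mul_of_nonneg_right hε' (Nat.cast_nonneg (α := ℝ) (Nat.card (S → Fin N → Bool)))
  linarith
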